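/- Let α* and α*_τ be the (unique) fixed points of the QMDP operator F and the soft QMDP operator F_τ, respectively. Then α*(s,a) ≤ α*_τ(s,a) for all (s,a) ∈ S × A, and the fixed points satisfy ‖α* − α*_τ‖_∞ ≤ γτ ln|A| / (1 − γ). -/

import Mathlib

open Finset

/-- The soft maximum of a finite family dominates each of its members. -/
theorem le_mul_log_sum_exp_div {A : Type*} [Fintype A] {τ : ℝ} (hτ : 0 < τ) (f : A → ℝ) (a : A) :
    f a ≤ τ * Real.log (∑ a', Real.exp (f a' / τ)) := by
  have h : Real.exp (f a / τ) ≤ ∑ a', Real.exp (f a' / τ) :=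
    single_le_sum (f := fun a' => Real.exp (f a' / τ)) (fun _ _ => (Real.exp_pos _).le)
      (mem_univ a)
  have h' : f a / τ ≤ Real.log (∑ a', Real.exp (f a' / τ)) :=
    (Real.le_log_iff_exp_le ((Real.exp_pos _).trans_le h)).2 h
  rwa [div_le_iff₀' hτ] at h'

/-- The soft maximum exceeds an upper bound of the family by at most `τ log |A|`. -/
theorem mul_log_sum_exp_div_le {A : Type*} [Fintype A] [Nonempty A] {τ : ℝ} (hτ : 0 < τ)
    {f : A → ℝ} {M : ℝ} (hM : ∀ a, f a ≤ M) :
    τ * Real.log (∑ a, Real.exp (f a / τ)) ≤ M + τ * Real.log (Fintype.card A) := by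
  have hsum : ∑ a, Real.exp (f a / τ) ≤ Fintype.card A * Real.exp (M / τ) := by
    refine (sum_le_card_nsmul univ _ (Real.exp (M / τ)) fun a _ => ?_).trans_eq (by simp)
    exact Real.exp_le_exp.2 (div_le_div_of_nonneg_right (hM a) hτ.le)
  have hpos : 0 < ∑ a, Real.exp (f a / τ) :=
    sum_pos (fun _ _ => Real.exp_pos _) univ_nonempty
  have hlog := Real.log_le_log hpos hsum
  rw [Real.log_mul (by simp) (Real.exp_ne_zero _), Real.log_exp] at hlog
  calc τ * Real.log (∑ a, Real.exp (f a / τ))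
      ≤ τ * (Real.log (Fintype.card A) + M / τ) := mul_le_mul_of_nonneg_left hlog hτ.le
    _ = M + τ * Real.log (Fintype.card A) := by field_simp; ring

/-- Averaging against a probability vector preserves a pointwise bound up to a constant. -/
theorem sum_mul_le_sum_mul_add {S : Type*} [Fintype S] {p V W : S → ℝ} {e : ℝ}
    (hp0 : ∀ s, 0 ≤ p s) (hp1 : ∑ s, p s = 1) (h : ∀ s, V s ≤ W s + e) :
    ∑ s, p s * V s ≤ ∑ s, p s * W s + e :=
  calc ∑ s, p s * V s ≤ ∑ s, p s * (W s + e) :=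
        sum_le_sum fun s _ => mul_le_mul_of_nonneg_left (h s) (hp0 s)
    _ = ∑ s, p s * W s + e := by simp only [mul_add, sum_add_distrib, ← sum_mul, hp1, one_mul]

/-- If every uniform one-sided bound `x ≤ y + D` improves to `x ≤ y + γ (D + c)`, then
`x ≤ y + γ c / (1 - γ)`. -/
theorem le_add_div_of_bound_improves {ι : Type*} [Finite ι] {x y : ι → ℝ} {γ c : ℝ}
    (hγ : γ < 1)
    (h : ∀ D, (∀ i, x i ≤ y i + D) → ∀ i, x i ≤ y i + γ * (D + c)) (i : ι) :
    x i ≤ y i + γ * c / (1 - γ) := by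
  have : Nonempty ι := ⟨i⟩
  obtain ⟨j, hj⟩ := Finite.exists_max fun k => x k - y k
  have hD := h (x j - y j) (fun k => by linarith [hj k]) j
  have hle : x j - y j ≤ γ * c / (1 - γ) := by
    rw [le_div_iff₀ (by linarith)]
    linarith
  linarith [hj i]

/-- Let `α*` and `α*_τ` be fixed points of the QMDP operator `F` and the soft QMDP
operator `F_τ` respectively. Then `α* ≤ α*_τ` pointwise, and
`‖α* − α*_τ‖_∞ ≤ γ τ ln|A| / (1 − γ)`. -/
theorem qmdp_soft_qmdp_fixed_point_bound
    {S A : Type*} [Fintype S] [Fintype A] [Nonempty S] [Nonempty A]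
    (T : S → A → S → ℝ)
    (hT0 : ∀ s a s', 0 ≤ T s a s') (hT1 : ∀ s a s', T s a s' ≤ 1)
    (hTsum : ∀ s a, ∑ s', T s a s' = 1)
    (R : S → A → ℝ) (γ : ℝ) (hγ0 : 0 < γ) (hγ1 : γ < 1)
    (τ : ℝ) (hτ : 0 < τ)
    (F : (S × A → ℝ) → (S × A → ℝ))
    (hF : ∀ α (s : S) (a : A), F α (s, a) =
      R s a + γ * ∑ s', T s a s' * (univ.sup' univ_nonempty (fun a' => α (s', a'))))
    (Fτ : (S × A → ℝ) → (S × A → ℝ))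
    (hFτ : ∀ α (s : S) (a : A), Fτ α (s, a) =
      R s a + γ * ∑ s', T s a s' * (τ * Real.log (∑ a', Real.exp (α (s', a') / τ))))
    (αstar αstarτ : S × A → ℝ)
    (hstar : F αstar = αstar) (hstarτ : Fτ αstarτ = αstarτ) :
    (∀ (s : S) (a : A), αstar (s, a) ≤ αstarτ (s, a)) ∧
    ‖αstar - αstarτ‖ ≤ γ * τ * Real.log (Fintype.card A) / (1 - γ) := by
  have hα (s : S) (a : A) := (congrFun hstar (s, a)).symm.trans (hF αstar s a)
  have hατ (s : S) (a : A) := (congrFun hstarτ (s, a)).symm.trans (hFτ αstarτ s a)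
  have hlow : ∀ i, αstar i ≤ αstarτ i + γ * 0 / (1 - γ) := by
    refine le_add_div_of_bound_improves hγ1 fun D hD => ?_
    rintro ⟨s, a⟩
    rw [hα, hατ, add_assoc, ← mul_add, add_zero]
    gcongr
    refine sum_mul_le_sum_mul_add (hT0 s a) (hTsum s a) fun s' => ?_
    refine sup'_le _ _ fun a' _ => (hD (s', a')).trans ?_
    gcongr
    exact le_mul_log_sum_exp_div hτ (fun b => αstarτ (s', b)) a'
  have hupp : ∀ i, αstarτ i ≤ αstar i + γ * (τ * Real.log (Fintype.card A)) / (1 - γ) := by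
    refine le_add_div_of_bound_improves hγ1 fun D hD => ?_
    rintro ⟨s, a⟩
    rw [hα, hατ, add_assoc, ← mul_add]
    gcongr
    refine sum_mul_le_sum_mul_add (hT0 s a) (hTsum s a) fun s' => ?_
    rw [← add_assoc]
    refine mul_log_sum_exp_div_le hτ fun a' => (hD (s', a')).trans ?_
    gcongr
    exact le_sup' (fun b => αstar (s', b)) (mem_univ a')
  simp only [mul_zero, zero_div, add_zero] at hlow
  refine ⟨fun s a => hlow (s, a), (pi_norm_le_iff_of_nonempty _).2 fun i => ?_⟩
  rw [Pi.sub_apply, Real.norm_eq_abs, abs_of_nonpos (sub_nonpos.2 (hlow i)), mul_assoc]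
  linarith [hupp i]
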